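/- Let A be a unital C*-algebra with unit 1, let J be an algebraically essential closed right ideal of A, and let a ∈ A. Then ‖a‖ = inf { λ ∈ ℝ : λ > 0 and x*(λ²·1 − a*a)x ≥ 0 for all x ∈ J }. -/

import Mathlib

variable {A : Type*} [CStarAlgebra A] [PartialOrder A] [StarOrderedRing A]

/-- A submodule `J ⊆ A` is a right ideal if it is closed under right multiplication
by arbitrary elements of `A`. -/
def IsRightIdeal (J : Submodule ℂ A) : Prop :=
  ∀ x ∈ J, ∀ a : A, x * a ∈ J

/-- A right ideal `J` is algebraically essential if it has nonzero intersection with every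
nonzero right ideal of `A`. -/
def IsAlgEssential (J : Submodule ℂ A) : Prop :=
  ∀ K : Submodule ℂ A, IsRightIdeal K → K ≠ ⊥ → J ⊓ K ≠ ⊥

/-- If `c` is self-adjoint and `star x * c * x` is nonnegative for every `x` in an algebraically
essential subspace, then `c` is nonnegative. -/
theorem IsAlgEssential.nonneg_of_forall_conjugate_nonneg {J : Submodule ℂ A}
    (hJ : IsAlgEssential J) {c : A} (hc : IsSelfAdjoint c)
    (h : ∀ x ∈ J, 0 ≤ star x * c * x) : 0 ≤ c := by
  rw [← CFC.negPart_eq_zero_iff c hc]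
  by_contra hne
  have hq : 0 ≤ c⁻ := CFC.negPart_nonneg c
  have hKr : IsRightIdeal (LinearMap.range (LinearMap.mulLeft ℂ (c⁻))) := by
    rintro _ ⟨d, rfl⟩ b
    exact ⟨d * b, by simp [mul_assoc]⟩
  have hK : LinearMap.range (LinearMap.mulLeft ℂ (c⁻)) ≠ ⊥ := fun hbot ↦
    hne (by simpa using (Submodule.eq_bot_iff _).mp hbot (c⁻) ⟨1, by simp⟩)
  obtain ⟨x, ⟨hxJ, ⟨d, hd⟩⟩, hx0⟩ := Submodule.exists_mem_ne_zero_of_ne_bot (hJ _ hKr hK)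
  replace hd : c⁻ * d = x := hd
  have hcx : c * x = -(c⁻ * x) := by
    conv_lhs => rw [← CFC.posPart_sub_negPart c hc]
    rw [sub_mul, ← hd, ← mul_assoc, CFC.posPart_mul_negPart, zero_mul, zero_sub]
  have hxqx : star x * c⁻ * x = 0 := by
    refine le_antisymm ?_ (star_left_conjugate_nonneg hq x)
    have := h x hxJ
    rwa [mul_assoc, hcx, mul_neg, ← mul_assoc, neg_nonneg] at this
  obtain ⟨s, hs⟩ := CStarAlgebra.nonneg_iff_eq_star_mul_self.mp hq
  have hsx : s * x = 0 := by
    rw [← CStarRing.star_mul_self_eq_zero_iff, star_mul, ← hxqx, hs]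
    simp only [mul_assoc]
  have hqx : c⁻ * x = 0 := by rw [hs, mul_assoc, hsx, mul_zero]
  refine hx0 ((CStarRing.star_mul_self_eq_zero_iff x).mp ?_)
  conv_lhs => rw [← hd, star_mul, hq.isSelfAdjoint.star_eq, hd, mul_assoc, hqx, mul_zero]

/-- For `l ≥ 0`, the norm of `a` is at most `l` if and only if `l ^ 2 - star a * a` is
nonnegative. -/
theorem CStarAlgebra.norm_le_iff_sq_smul_one_sub_nonneg (a : A) {l : ℝ} (hl : 0 ≤ l) :
    ‖a‖ ≤ l ↔ 0 ≤ ((l : ℂ) ^ 2) • (1 : A) - star a * a := by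
  have hsmul : ((l : ℂ) ^ 2) • (1 : A) = algebraMap ℝ A (l ^ 2) := by
    rw [Algebra.algebraMap_eq_smul_one, ← Complex.ofReal_pow, Complex.coe_smul]
  rw [sub_nonneg, hsmul, ← CStarAlgebra.norm_le_iff_le_algebraMap _ (sq_nonneg l)
    (star_mul_self_nonneg a), CStarRing.norm_star_mul_self, ← sq,
    sq_le_sq₀ (norm_nonneg a) hl]

theorem stmt4 (J : Submodule ℂ A) (hJr : IsRightIdeal J) (hJc : IsClosed (J : Set A))
    (hJe : IsAlgEssential J) (a : A) :
    ‖a‖ = sInf {l : ℝ | 0 < l ∧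
      ∀ x ∈ J, 0 ≤ star x * (((l : ℂ) ^ 2) • (1 : A) - star a * a) * x} := by
  have hset : {l : ℝ | 0 < l ∧
      ∀ x ∈ J, 0 ≤ star x * (((l : ℂ) ^ 2) • (1 : A) - star a * a) * x} =
      {l : ℝ | 0 < l ∧ ‖a‖ ≤ l} := by
    ext l
    refine and_congr_right fun hl ↦ ?_
    rw [CStarAlgebra.norm_le_iff_sq_smul_one_sub_nonneg a hl.le]
    refine ⟨hJe.nonneg_of_forall_conjugate_nonneg ?_,
      fun h x _ ↦ star_left_conjugate_nonneg h x⟩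
    simp [IsSelfAdjoint]
  rw [hset]
  refine le_antisymm (le_csInf ⟨‖a‖ + 1, by positivity, by simp⟩ fun l hl ↦ hl.2) ?_
  refine le_of_forall_pos_le_add fun ε hε ↦ csInf_le ⟨0, fun l hl ↦ hl.1.le⟩ ?_
  exact ⟨by positivity, by linarith⟩
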